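/- arXiv:2602.14716 — 4 statements merged into one kernel-verified Lean document; each statement's English description precedes it below -/
import Mathlib

section
/- For every integer r ≥ 3 there exists q₀ such that for every odd prime power q ≥ q₀ there exists an r-uniform linear hypergraph H on exactly rq vertices with exactly (q² + 2q − 1)/2 edges that contains no copy of the r×r grid G_{r×r}. -/
open Polynomial in
theorem natDegree_coeff_prod_X_sub_C_le {ι R : Type*} [CommRing R] (s : Finset ι) (L : ι → R[X])
    (hL : ∀ k, (L k).natDegree ≤ 1) (j : ℕ) :
    ((∏ k ∈ s, (X - C (L k))).coeff j).natDegree ≤ s.card - j := by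
  classical
  nontriviality R
  induction s using Finset.induction_on generalizing j with
  | empty =>
    rw [Finset.prod_empty, coeff_one]
    split_ifs <;> simp
  | insert a s ha ih =>
    have hdeg : (∏ k ∈ s, (X - C (L k))).natDegree = s.card := natDegree_finsetProd_X_sub_C_eq_card s L
    rw [Finset.prod_insert ha, Finset.card_insert_of_notMem ha, mul_comm, mul_sub, coeff_sub,
      coeff_mul_C]
    refine (natDegree_sub_le _ _).trans (max_le ?_ ?_)
    · cases j with
      | zero => simp
      | succ j =>
        rw [coeff_mul_X]
        exact (ih j).trans (by omega)
    · by_cases hj : s.card < j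
      · rw [coeff_eq_zero_of_natDegree_lt (hdeg ▸ hj)]
        simp
      · exact natDegree_mul_le.trans ((add_le_add (ih j) (hL a)).trans (by omega))

open Polynomial in
theorem exists_eq_prod_X_sub_C_mul {n : ℕ} {F : Type*} [Field F]
    {a : Fin n → F} (ha : Function.Injective a) {g : F[X]} (hg : ∀ i, g.eval (a i) = 0) :
    ∃ h : F[X], g = (∏ i, (X - C (a i))) * h ∧ h.natDegree ≤ g.natDegree - n ∧
      (g.natDegree < n → h = 0) := by
  have hdvd : (∏ i, (X - C (a i))) ∣ g :=
    Finset.prod_dvd_of_coprime (fun i _ j _ hij => isCoprime_X_sub_C_of_isUnit_sub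
      (sub_ne_zero.mpr (ha.ne hij)).isUnit) fun i _ => dvd_iff_isRoot.mpr (hg i)
  obtain ⟨h, rfl⟩ := hdvd
  have hmon : (∏ i, (X - C (a i))).Monic := monic_prod_X_sub_C _ _
  have hdeg : (∏ i, (X - C (a i))).natDegree = n := by simp
  refine ⟨h, rfl, ?_, fun hlt => ?_⟩
  all_goals
    by_cases h0 : h = 0
    · simp [h0]
    · rw [hmon.natDegree_mul' h0, hdeg] at *
      omega

theorem two_mul_card_filter_isSquare {F : Type*} [Field F] [Fintype F] [DecidableEq F]
    (hF : ringChar F ≠ 2) :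
    2 * (Finset.univ.filter fun a : F => IsSquare a).card = Fintype.card F + 1 := by
  have h := quadraticChar_sum_zero hF
  have h2 : ∀ a : F, (2 * if IsSquare a then 1 else 0 : ℤ) =
      quadraticChar F a + 1 + if a = 0 then 1 else 0 := by
    intro a
    by_cases h0 : a = 0
    · simp [h0]
    · by_cases hs : IsSquare a
      · simp [h0, hs, (quadraticChar_one_iff_isSquare h0).mpr hs]
      · simp [h0, hs, quadraticChar_neg_one_iff_not_isSquare.mpr hs]
  zify
  rw [Finset.card_filter]
  push_cast
  rw [Finset.mul_sum, Finset.sum_congr rfl fun a _ => h2 a, Finset.sum_add_distrib,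
    Finset.sum_add_distrib, h]
  simp

open Polynomial in
theorem exists_eq_of_grid_of_parabola {n : ℕ} {F : Type*} [Field F] (hn : 2 ≤ n)
    (h2 : (2 : F) ≠ 0) (x y x' y' : Fin (n + 1) → F) {a : Fin n → F} (ha : Function.Injective a)
    (hline : ∀ i, ∃ σ : Equiv.Perm (Fin (n + 1)),
      ∀ k, y k + x k * a i = y' (σ k) + x' (σ k) * a i)
    {t : Fin (n + 1) → F} (ht : Function.Injective t) (hta : ∀ k i, t k ^ 2 ≠ a i)
    (hrow : ∀ k, y k + x k * t k ^ 2 = 2 * t k)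
    (hcol : ∀ k, ∃ l, y' l + x' l * t k ^ 2 = 2 * t k) :
    ∃ k l, x k = x' l ∧ y k = y' l := by
  set L : (Fin (n + 1) → F) → (Fin (n + 1) → F) → Fin (n + 1) → F[X] :=
    fun x y k => C (y k) + C (x k) * X with hL
  have hL1 : ∀ x y k, (L x y k).natDegree ≤ 1 := fun x y k => by
    simpa only [hL, add_comm] using natDegree_linear_le
  set P : (Fin (n + 1) → F) → (Fin (n + 1) → F) → F[X][X] :=
    fun x y => ∏ k, (X - C (L x y k)) with hP
  have hPmap : ∀ x y α, (P x y).map (evalRingHom α) = ∏ k, (X - C (y k + x k * α)) := by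
    intro x y α
    simp [hP, hL, Polynomial.map_prod]
  have hPeval : ∀ x y α β, (P x y).evalEval α β = ∏ k, (β - (y k + x k * α)) := by
    intro x y α β
    simp [hP, hL, evalEval_prod, evalEval_sub, evalEval_C]
  set D := P x y - P x' y' with hD
  have hDdeg : ∀ j, (D.coeff j).natDegree ≤ n + 1 - j := by
    intro j
    rw [hD, coeff_sub]
    refine (natDegree_sub_le _ _).trans (max_le ?_ ?_)
    · simpa using natDegree_coeff_prod_X_sub_C_le Finset.univ (L x y) (hL1 x y) j
    · simpa using natDegree_coeff_prod_X_sub_C_le Finset.univ (L x' y') (hL1 x' y') j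
  have hDa : ∀ j i, (D.coeff j).eval (a i) = 0 := by
    intro j i
    obtain ⟨σ, hσ⟩ := hline i
    have hmap : D.map (evalRingHom (a i)) = 0 := by
      rw [hD, Polynomial.map_sub, hPmap, hPmap, sub_eq_zero]
      exact Fintype.prod_equiv σ _ _ fun k => by rw [hσ k]
    simpa using congrArg (fun p => p.coeff j) hmap
  choose h hfac hdeg hzero using fun j =>
    exists_eq_prod_X_sub_C_mul ha (hDa j)
  have hD2 : ∀ j, 2 ≤ j → D.coeff j = 0 := by
    intro j hj
    have := hDdeg j
    rw [hfac j, hzero j (by omega), mul_zero]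
  have hDlin : D = C (D.coeff 0) + C (D.coeff 1) * X := by
    ext1 j
    match j with
    | 0 => simp
    | 1 => simp
    | j + 2 => simp [hD2 (j + 2) (by omega)]
  obtain ⟨d, e, hde⟩ := exists_eq_X_add_C_of_natDegree_le_one
    ((hdeg 0).trans (by have := hDdeg 0; omega) : (h 0).natDegree ≤ 1)
  obtain ⟨c, hc⟩ := natDegree_eq_zero.mp
    (Nat.le_zero.mp ((hdeg 1).trans (by have := hDdeg 1; omega)) : (h 1).natDegree = 0)
  have hroot : ∀ k, d * t k ^ 2 + e + c * (2 * t k) = 0 := by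
    intro k
    have h0 : D.evalEval (t k ^ 2) (2 * t k) = 0 := by
      obtain ⟨l, hl⟩ := hcol k
      rw [hD, evalEval_sub, hPeval, hPeval,
        Finset.prod_eq_zero (Finset.mem_univ k) (by rw [hrow k, sub_self]),
        Finset.prod_eq_zero (Finset.mem_univ l) (by rw [hl, sub_self]), sub_zero]
    rw [hDlin, hfac 0, hfac 1, hde, ← hc, evalEval_add, evalEval_mul, evalEval_C, evalEval_C,
      evalEval_X, eval_mul, eval_mul, mul_assoc, ← mul_add, eval_prod] at h0
    refine (mul_eq_zero.mp h0).resolve_left ?_ |> fun h => by simpa using h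
    exact Finset.prod_ne_zero_iff.mpr fun i _ => by simpa [sub_eq_zero] using hta k i
  have hquad : C d * X ^ 2 + C (2 * c) * X + C e = 0 :=
    eq_zero_of_natDegree_lt_card_of_eval_eq_zero _ ht
      (fun k => by simpa using (by linear_combination hroot k :
        d * t k ^ 2 + 2 * c * t k + e = 0))
      (natDegree_quadratic_le.trans_lt (by simp; omega))
  have hd : d = 0 := by simpa [coeff_X, coeff_C] using congrArg (fun p => p.coeff 2) hquad
  have hcz : c = 0 := by
    simpa [coeff_X, coeff_C, h2] using congrArg (fun p => p.coeff 1) hquad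
  have he : e = 0 := by simpa using congrArg (fun p => p.coeff 0) hquad
  have hD0 : D = 0 := by
    rw [hDlin, hfac 0, hfac 1, hde, ← hc, hd, hcz, he]
    simp
  have hPP : (P x' y').eval (L x y 0) = 0 := by
    rw [← sub_eq_zero.mp hD0, hP, eval_prod]
    exact Finset.prod_eq_zero (Finset.mem_univ 0) (by simp)
  rw [hP, eval_prod] at hPP
  obtain ⟨l, -, hl⟩ := Finset.prod_eq_zero_iff.mp hPP
  have hLL : L x y 0 = L x' y' l := by simpa [sub_eq_zero] using hl
  refine ⟨0, l, ?_, ?_⟩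
  · simpa [hL] using congrArg (fun p => p.coeff 1) hLL
  · simpa [hL] using congrArg (fun p => p.coeff 0) hLL

/-- The pairs `(x, y)` for which the line `Z = y + x A` meets the parabola `Z² = 4 A`,
parametrized by `t ↦ (t², 2 t)`. -/
theorem card_filter_exists_mul_sq {F : Type*} [Field F] [Fintype F] [DecidableEq F]
    (hF : ringChar F ≠ 2) :
    2 * (Finset.univ.filter fun p : F × F => ∃ t, p.2 + p.1 * t ^ 2 = 2 * t).card + 1 =
      Fintype.card F ^ 2 + 2 * Fintype.card F := by
  have h2 : (2 : F) ≠ 0 := Ring.two_ne_zero hF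
  have hfib : ∀ x : F, (∑ y : F, if ∃ t, y + x * t ^ 2 = 2 * t then 1 else 0) =
      if x = 0 then Fintype.card F else (Finset.univ.filter fun a : F => IsSquare a).card := by
    intro x
    split_ifs with hx
    · rw [← Finset.card_filter, Finset.filter_true_of_mem, Finset.card_univ]
      intro y _
      exact ⟨y / 2, by rw [hx]; field_simp; ring⟩
    · rw [Finset.card_filter]
      refine Fintype.sum_equiv
        ((Equiv.mulLeft₀ x hx).trans (Equiv.subLeft 1)) _ _ fun y => ?_
      have hmul : Equiv.mulLeft₀ x hx y = x * y := rfl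
      refine if_congr ⟨?_, ?_⟩ rfl rfl
      · rintro ⟨t, ht⟩
        refine ⟨1 - x * t, ?_⟩
        simp only [Equiv.trans_apply, hmul, Equiv.subLeft_apply]
        linear_combination (-x) * ht
      · rintro ⟨s, hs⟩
        simp only [Equiv.trans_apply, hmul, Equiv.subLeft_apply] at hs
        refine ⟨(1 - s) / x, ?_⟩
        field_simp
        linear_combination -hs
  have hsq := two_mul_card_filter_isSquare hF
  have hq : 1 ≤ Fintype.card F := Fintype.card_pos
  rw [Finset.card_filter, Fintype.sum_prod_type, Finset.sum_congr rfl fun x _ => hfib x,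
    ← Finset.add_sum_erase _ _ (Finset.mem_univ 0), if_pos rfl,
    Finset.sum_congr rfl fun x hx => if_neg (Finset.ne_of_mem_erase hx), Finset.sum_const,
    Finset.card_erase_of_mem (Finset.mem_univ 0), Finset.card_univ, smul_eq_mul]
  obtain ⟨m, hm⟩ := Nat.exists_eq_add_of_le' hq
  rw [hm] at hsq ⊢
  rw [Nat.add_sub_cancel]
  linear_combination m * hsq

theorem exists_perm_of_grid {ι F P W : Type*} {r : ℕ} [Fintype ι] [DecidableEq W]
    {e : ι × F → W} (he : Function.Injective e) (f : ι → P → F) {v : Fin r → Fin r → W}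
    (hv : Function.Injective fun p : Fin r × Fin r => v p.1 p.2) {p p' : Fin r → P}
    (hp : ∀ k, (Finset.univ.image fun i => e (i, f i (p k))) = Finset.univ.image fun l => v k l)
    (hp' : ∀ l, (Finset.univ.image fun i => e (i, f i (p' l))) = Finset.univ.image fun k => v k l)
    (i : ι) :
    (Function.Injective fun k => f i (p k)) ∧
      ∃ σ : Equiv.Perm (Fin r), ∀ k, f i (p k) = f i (p' (σ k)) := by
  have hcol : ∀ k, ∃ l, v k l = e (i, f i (p k)) := fun k => by
    have hmem := Finset.mem_image_of_mem (fun i => e (i, f i (p k))) (Finset.mem_univ i)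
    simpa [hp k] using hmem
  choose σ hσ using hcol
  have hf : ∀ k, f i (p k) = f i (p' (σ k)) := by
    intro k
    have hmem := Finset.mem_image_of_mem (fun k' => v k' (σ k)) (Finset.mem_univ k)
    rw [← hp' (σ k)] at hmem
    obtain ⟨i', -, hi'⟩ := Finset.mem_image.mp hmem
    have heq := he (hi'.trans (hσ k))
    obtain ⟨rfl, h⟩ := Prod.mk.inj heq
    exact h.symm
  have hinj : Function.Injective fun k => f i (p k) := by
    intro k k' h
    have heq : v k (σ k) = v k' (σ k') := by
      rw [hσ k, hσ k']
      exact congrArg (fun z => e (i, z)) h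
    exact congrArg Prod.fst (@hv (k, σ k) (k', σ k') heq)
  have hσinj : Function.Injective σ := fun k k' h => hinj (by simp only [hf, h])
  exact ⟨hinj, Equiv.ofBijective σ (Finite.injective_iff_bijective.mp hσinj), hf⟩

theorem exists_injective_not_isSquare {F : Type*} [Field F] [Fintype F] (hF : ringChar F ≠ 2)
    {n : ℕ} (hn : 2 * n + 1 ≤ Fintype.card F) :
    ∃ a : Fin n → F, Function.Injective a ∧ ∀ i, ¬ IsSquare (a i) := by
  classical
  have hsq := two_mul_card_filter_isSquare hF
  have hadd := Finset.card_filter_add_card_filter_not (s := Finset.univ) fun a : F => IsSquare a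
  rw [Finset.card_univ] at hadd
  obtain ⟨g⟩ : Nonempty (Fin n ↪ {a : F // ¬ IsSquare a}) := by
    refine Function.Embedding.nonempty_of_card_le ?_
    rw [Fintype.card_fin, Fintype.card_subtype]
    omega
  exact ⟨fun i => g i, Subtype.val_injective.comp g.injective, fun i => (g i).2⟩

theorem exists_linear_grid_free {F : Type*} [Field F] [Fintype F] (hF : ringChar F ≠ 2)
    {n q : ℕ} (hn : 2 ≤ n) (hcard : Fintype.card F = q) (hq : 2 * n + 1 ≤ q) :
    ∃ E : Finset (Finset (Fin ((n + 1) * q))),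
      (∀ e ∈ E, e.card = n + 1) ∧
      (∀ e ∈ E, ∀ f ∈ E, e ≠ f → (e ∩ f).card ≤ 1) ∧
      E.card = (q ^ 2 + 2 * q - 1) / 2 ∧
      ¬ ∃ v : Fin (n + 1) → Fin (n + 1) → Fin ((n + 1) * q),
          (Function.Injective fun p : Fin (n + 1) × Fin (n + 1) => v p.1 p.2) ∧
          (∀ i, (Finset.univ.image fun j => v i j) ∈ E) ∧
          (∀ j, (Finset.univ.image fun i => v i j) ∈ E) ∧
          Function.Injective
            (Sum.elim (fun i => Finset.univ.image fun j => v i j)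
                      (fun j => Finset.univ.image fun i => v i j)) := by
  classical
  obtain ⟨a, ha, hasq⟩ := exists_injective_not_isSquare hF (hq.trans_eq hcard.symm)
  have hsa : ∀ (s : F) i, s ^ 2 ≠ a i := fun s i h => hasq i ⟨s, by rw [← h, sq]⟩
  let S := Finset.univ.filter fun z : F × F => ∃ t, z.2 + z.1 * t ^ 2 = 2 * t
  have hScard : 2 * S.card + 1 = q ^ 2 + 2 * q := by
    rw [← hcard]
    convert card_filter_exists_mul_sq hF
  have hroot : ∀ z : F × F, ∃ t, z ∈ S → z.2 + z.1 * t ^ 2 = 2 * t := by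
    intro z
    by_cases hz : z ∈ S
    · obtain ⟨t, ht⟩ := (Finset.mem_filter.mp hz).2
      exact ⟨t, fun _ => ht⟩
    · exact ⟨0, fun h => absurd h hz⟩
  choose t ht using hroot
  let f : Option (Fin n) → F × F → F := fun i z => i.elim (t z) fun i => z.2 + z.1 * a i
  obtain ⟨e⟩ : Nonempty (Option (Fin n) × F ≃ Fin ((n + 1) * q)) :=
    ⟨Fintype.equivOfCardEq (by simp [hcard])⟩
  let edge : F × F → Finset (Fin ((n + 1) * q)) := fun z =>
    Finset.univ.image fun i => e (i, f i z)
  have hedge_card : ∀ z, (edge z).card = n + 1 := by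
    intro z
    rw [Finset.card_image_of_injective _ fun i j h => congrArg Prod.fst (e.injective h)]
    simp
  have hmem : ∀ i s z, e (i, s) ∈ edge z ↔ f i z = s := by
    intro i s z
    simp [edge]
  have hmeet : ∀ (b c : F) (z w : F × F), b ≠ c → z.2 + z.1 * b = w.2 + w.1 * b →
      z.2 + z.1 * c = w.2 + w.1 * c → z = w := by
    intro b c z w hbc hb hc
    have h1 : z.1 = w.1 := by
      have : (z.1 - w.1) * (b - c) = 0 := by linear_combination hb - hc
      exact sub_eq_zero.mp ((mul_eq_zero.mp this).resolve_right (sub_ne_zero.mpr hbc))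
    exact Prod.ext h1 (by linear_combination hb - b * h1)
  have hroot_eq : ∀ z ∈ S, ∀ w ∈ S, t z = t w →
      z.2 + z.1 * t z ^ 2 = w.2 + w.1 * t z ^ 2 := by
    intro z hz w hw h
    rw [ht z hz, h, ht w hw]
  have hlin : ∀ z ∈ S, ∀ w ∈ S, ∀ i j, i ≠ j → f i z = f i w → f j z = f j w → z = w := by
    intro z hz w hw i j hij hi hj
    match i, j with
    | none, none => exact absurd rfl hij
    | none, some j => exact hmeet _ _ z w (hsa (t z) j) (hroot_eq z hz w hw hi) hj
    | some i, none => exact hmeet _ _ z w (hsa (t z) i) (hroot_eq z hz w hw hj) hi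
    | some i, some j =>
      exact hmeet _ _ z w (ha.ne fun h => hij (congrArg some h)) hi hj
  have hlinear : ∀ z ∈ S, ∀ w ∈ S, z ≠ w → (edge z ∩ edge w).card ≤ 1 := by
    intro z hz w hw hzw
    refine Finset.card_le_one.mpr fun b hb c hc => ?_
    obtain ⟨⟨i, s⟩, rfl⟩ := e.surjective b
    obtain ⟨⟨j, s'⟩, rfl⟩ := e.surjective c
    simp only [Finset.mem_inter, hmem] at hb hc
    by_cases hij : i = j
    · subst hij
      rw [← hb.1, ← hc.1]
    · exact absurd (hlin z hz w hw i j hij (hb.1.trans hb.2.symm) (hc.1.trans hc.2.symm)) hzw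
  have hedge_inj : Set.InjOn edge S := by
    intro z hz w hw h
    by_contra hzw
    have := hlinear z hz w hw hzw
    rw [h, Finset.inter_self, hedge_card] at this
    omega
  refine ⟨S.image edge, ?_, ?_, ?_, ?_⟩
  · intro b hb
    obtain ⟨z, -, rfl⟩ := Finset.mem_image.mp hb
    exact hedge_card z
  · intro b hb c hc hbc
    obtain ⟨z, hz, rfl⟩ := Finset.mem_image.mp hb
    obtain ⟨w, hw, rfl⟩ := Finset.mem_image.mp hc
    exact hlinear z hz w hw fun h => hbc (h ▸ rfl)
  · rw [Finset.card_image_of_injOn hedge_inj]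
    omega
  · rintro ⟨v, hv, hrow, hcol, hdist⟩
    choose z hzS hz using fun k => Finset.mem_image.mp (hrow k)
    choose w hwS hw using fun l => Finset.mem_image.mp (hcol l)
    have hgrid := exists_perm_of_grid e.injective f hv hz hw
    obtain ⟨htinj, σ, hσ⟩ := hgrid none
    obtain ⟨k, l, h1, h2⟩ := exists_eq_of_grid_of_parabola hn (Ring.two_ne_zero hF)
      (fun k => (z k).1) (fun k => (z k).2) (fun l => (w l).1) (fun l => (w l).2) ha
      (fun i => (hgrid (some i)).2) htinj (fun k i => hsa _ i) (fun k => ht _ (hzS k))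
      fun k => ⟨σ k, by
        have h : t (z k) = t (w (σ k)) := hσ k
        simpa only [f, Option.elim, h] using ht _ (hwS (σ k))⟩
    have hkl : (Finset.univ.image fun j => v k j) = Finset.univ.image fun i => v i l := by
      rw [← hz k, ← hw l, Prod.ext h1 h2]
    exact Sum.inl_ne_inr (@hdist (Sum.inl k) (Sum.inr l) hkl)

/-- For every `r ≥ 3` there is `q₀` such that for every odd prime power
`q ≥ q₀` there exists an `r`-uniform linear hypergraph on exactly `r·q` vertices with exactly
`(q² + 2q − 1)/2` edges containing no copy of the `r × r` grid. -/
theorem stmt1 (r : ℕ) (hr : 3 ≤ r) :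
    ∃ q₀ : ℕ, ∀ q : ℕ, q₀ ≤ q → (∃ p k : ℕ, p.Prime ∧ 0 < k ∧ q = p ^ k) → Odd q →
      ∃ E : Finset (Finset (Fin (r * q))),
        -- `r`-uniform
        (∀ e ∈ E, e.card = r) ∧
        -- linear
        (∀ e ∈ E, ∀ f ∈ E, e ≠ f → (e ∩ f).card ≤ 1) ∧
        -- exactly (q² + 2q − 1)/2 edges
        E.card = (q ^ 2 + 2 * q - 1) / 2 ∧
        -- no copy of the r × r grid
        ¬ ∃ v : Fin r → Fin r → Fin (r * q),
            -- r² distinct vertices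
            (Function.Injective fun p : Fin r × Fin r => v p.1 p.2) ∧
            -- each row is an edge
            (∀ i : Fin r, (Finset.univ.image fun j => v i j) ∈ E) ∧
            -- each column is an edge
            (∀ j : Fin r, (Finset.univ.image fun i => v i j) ∈ E) ∧
            -- the 2r edges are pairwise distinct
            Function.Injective
              (Sum.elim (fun i : Fin r => Finset.univ.image fun j => v i j)
                        (fun j : Fin r => Finset.univ.image fun i => v i j)) := by
  obtain ⟨n, rfl⟩ : ∃ n, r = n + 1 := ⟨r - 1, by omega⟩
  refine ⟨2 * n + 1, ?_⟩
  rintro q hq ⟨p, k, hp, hk, hpk⟩ hodd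
  have := Fact.mk hp
  let _ : Fintype (GaloisField p k) := Fintype.ofFinite _
  have hcard : Fintype.card (GaloisField p k) = q := by
    rw [← Nat.card_eq_fintype_card, hpk]
    exact GaloisField.card p k hk.ne'
  have hF : ringChar (GaloisField p k) ≠ 2 := by
    rw [Ne, FiniteField.even_card_iff_char_two, hcard]
    have := Nat.odd_iff.mp hodd
    omega
  exact exists_linear_grid_free hF (by omega) hcard hq
end

section
/- Fix r ≥ 3 and an odd prime power q. Let α₁, …, α_{r−1} be distinct nonsquares in F_q^×, let A = ⋃_{t=1}^{r−1} {(x, α_t) : x ∈ F_q}, and let B = {(x, x²) : x ∈ F_q}. For each non-horizontal affine line ℓ ⊆ F_q² with ℓ ∩ B ≠ ∅, let p(ℓ) be a chosen point of ℓ ∩ B, and define the edge e(ℓ) = (ℓ ∩ A) ∪ {p(ℓ)}. Then the hypergraph H with vertex set A ∪ B and edge set {e(ℓ) : ℓ non-horizontal, ℓ ∩ B ≠ ∅} is r-uniform (every edge has exactly r vertices) and linear (any two distinct edges intersect in at most one vertex). -/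
/-- Two lines that are not horizontal and share two distinct points coincide. -/
theorem nonhorizontal_line_eq_of_two_points {F : Type*} [Field F] {a b c a' b' c' : F}
    (ha : a ≠ 0) (ha' : a' ≠ 0) {P Q : F × F} (hPQ : P ≠ Q)
    (hP : a * P.1 + b * P.2 = c) (hQ : a * Q.1 + b * Q.2 = c)
    (hP' : a' * P.1 + b' * P.2 = c') (hQ' : a' * Q.1 + b' * Q.2 = c') :
    {pt : F × F | a * pt.1 + b * pt.2 = c} = {pt : F × F | a' * pt.1 + b' * pt.2 = c'} := by
  have hv : P.2 - Q.2 ≠ 0 := by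
    intro h
    have h2 : P.2 = Q.2 := sub_eq_zero.mp h
    refine hPQ (Prod.ext (mul_left_cancel₀ ha ?_) h2)
    rw [h2] at hP
    linear_combination hP - hQ
  have hb : a * b' = a' * b := by
    refine mul_right_cancel₀ hv ?_
    linear_combination a * (hP' - hQ') - a' * (hP - hQ)
  have hc : a * c' = a' * c := by
    linear_combination a' * hP - a * hP' + P.2 * hb
  ext pt
  simp only [Set.mem_ofPred_eq]
  constructor
  · intro h
    refine mul_left_cancel₀ ha ?_
    linear_combination a' * h + pt.2 * hb - hc
  · intro h
    refine mul_left_cancel₀ ha' ?_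
    linear_combination a * h - pt.2 * hb + hc

/-- A line that is not horizontal meets a union of `n` distinct horizontal lines in `n` points. -/
theorem ncard_nonhorizontal_line_inter_iUnion {F : Type*} [Field F] {n : ℕ} {α : Fin n → F}
    (hα : Function.Injective α) {a b c : F} (ha : a ≠ 0) :
    ({pt : F × F | a * pt.1 + b * pt.2 = c} ∩
      ⋃ t : Fin n, {pt : F × F | pt.2 = α t}).ncard = n := by
  have h : {pt : F × F | a * pt.1 + b * pt.2 = c} ∩ (⋃ t : Fin n, {pt : F × F | pt.2 = α t}) =
      Set.range fun t => ((c - b * α t) / a, α t) := by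
    ext ⟨x, y⟩
    simp only [Set.mem_inter_iff, Set.mem_ofPred_eq, Set.mem_iUnion, Set.mem_range, Prod.mk.injEq]
    constructor
    · rintro ⟨h, t, rfl⟩
      refine ⟨t, ?_, rfl⟩
      rw [div_eq_iff ha]
      linear_combination -h
    · rintro ⟨t, rfl, rfl⟩
      refine ⟨?_, t, rfl⟩
      field_simp
      ring
  rw [h, ← Set.image_univ, Set.ncard_image_of_injective _
    fun s t hst => hα (congrArg Prod.snd hst), Set.ncard_univ, Nat.card_fin]


/-- The hypergraph `H_{r,q}` built from `r − 1` horizontal lines at distinct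
nonsquare heights and the parabola `B`, with one edge `e(ℓ) = (ℓ ∩ A) ∪ {p(ℓ)}` for each
non-horizontal affine line `ℓ` meeting `B`, is `r`-uniform and linear. -/
theorem stmt5 (F : Type*) [Field F] [Fintype F] (hodd : Odd (Fintype.card F))
    (r : ℕ) (hr : 3 ≤ r)
    (α : Fin (r - 1) → F) (hαinj : Function.Injective α)
    (hαns : ∀ t, α t ≠ 0 ∧ ¬ ∃ x : F, x ^ 2 = α t)
    (A B : Set (F × F))
    (hA : A = ⋃ t : Fin (r - 1), {pt : F × F | pt.2 = α t})
    (hB : B = {pt : F × F | pt.2 = pt.1 ^ 2})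
    (p : Set (F × F) → F × F)
    (hp : ∀ ℓ : Set (F × F),
      (∃ a b c : F, a ≠ 0 ∧ ℓ = {pt : F × F | a * pt.1 + b * pt.2 = c}) →
      (ℓ ∩ B).Nonempty → p ℓ ∈ ℓ ∩ B)
    (E : Set (Set (F × F)))
    (hE : E = {e | ∃ ℓ : Set (F × F),
      (∃ a b c : F, a ≠ 0 ∧ ℓ = {pt : F × F | a * pt.1 + b * pt.2 = c}) ∧
      (ℓ ∩ B).Nonempty ∧ e = (ℓ ∩ A) ∪ {p ℓ}}) :
    -- `r`-uniform
    (∀ e ∈ E, e.ncard = r) ∧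
    -- linear
    (∀ e ∈ E, ∀ f ∈ E, e ≠ f → (e ∩ f).ncard ≤ 1) := by
  have hline : ∀ ℓ : Set (F × F), p ℓ ∈ ℓ → (ℓ ∩ A) ∪ {p ℓ} ⊆ ℓ := fun ℓ h =>
    Set.union_subset Set.inter_subset_left (Set.singleton_subset_iff.mpr h)
  subst hE
  constructor
  · rintro e ⟨ℓ, hℓ, hne, rfl⟩
    have hpB : p ℓ ∈ B := (hp ℓ hℓ hne).2
    have hpA : p ℓ ∉ ℓ ∩ A := by
      rintro ⟨-, h⟩
      rw [hB] at hpB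
      rw [hA] at h
      obtain ⟨t, ht⟩ := Set.mem_iUnion.mp h
      exact (hαns t).2 ⟨(p ℓ).1, hpB.symm.trans ht⟩
    obtain ⟨a, b, c, ha, hℓ'⟩ := hℓ
    have hcard : (ℓ ∩ A).ncard = r - 1 := by
      rw [hℓ', hA]
      exact ncard_nonhorizontal_line_inter_iUnion hαinj ha
    rw [Set.union_singleton, Set.ncard_insert_of_notMem hpA (Set.toFinite _), hcard]
    omega
  · rintro e ⟨ℓ, hℓ, hne, rfl⟩ f ⟨m, hm, hne', rfl⟩ hef
    rw [Set.ncard_le_one (Set.toFinite _)]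
    rintro P ⟨hPe, hPf⟩ Q ⟨hQe, hQf⟩
    by_contra hPQ
    have hPℓ := hline ℓ (hp ℓ hℓ hne).1 hPe
    have hQℓ := hline ℓ (hp ℓ hℓ hne).1 hQe
    have hPm := hline m (hp m hm hne').1 hPf
    have hQm := hline m (hp m hm hne').1 hQf
    have hℓm : ℓ = m := by
      obtain ⟨a, b, c, ha, rfl⟩ := hℓ
      obtain ⟨a', b', c', ha', rfl⟩ := hm
      exact nonhorizontal_line_eq_of_two_points ha ha' hPQ hPℓ hQℓ hPm hQm
    exact hef (by rw [hℓm])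
end

section
/- (Cayley–Bacharach in the plane.) Let K be an algebraically closed field and let r ≥ 3. Let g₁, g₂ ∈ K[X, Y, Z] be homogeneous polynomials of degree r with no common irreducible factor, and suppose that the set of common projective zeros of g₁ and g₂ consists of exactly r² distinct points x₁, …, x_{r²} of the projective plane over K. Then every homogeneous polynomial f ∈ K[X, Y, Z] of degree at most 2r − 3 that vanishes at r² − 1 of the points x₁, …, x_{r²} vanishes at all r² of them. -/
section Koszul

variable {A : Type*} [CommRing A] [IsDomain A] [DecompositionMonoid A]

/-- The syzygies of a relatively prime pair are generated by the Koszul syzygy. -/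
theorem IsRelPrime.exists_of_mul_add_mul_eq_zero {g₁ g₂ a b : A} (h : IsRelPrime g₁ g₂)
    (hg₂ : g₂ ≠ 0) (hab : a * g₁ + b * g₂ = 0) : ∃ c, a = c * g₂ ∧ b = -(c * g₁) := by
  obtain ⟨c, rfl⟩ : g₂ ∣ a := h.symm.dvd_of_dvd_mul_right ⟨-b, by linear_combination hab⟩
  refine ⟨c, mul_comm _ _, mul_right_cancel₀ hg₂ ?_⟩
  linear_combination hab

theorem IsRelPrime.mem_span_pair_of_koszul {g₁ g₂ p q h a₁ b₁ a₂ b₂ c : A}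
    (hpq : IsRelPrime p q) (hp : p ≠ 0) (h₁ : p * h = a₁ * g₁ + b₁ * g₂)
    (ha : q * a₁ - p * a₂ = c * g₂) (hb : q * b₁ - p * b₂ = -(c * g₁))
    (hc : c ∈ Ideal.span {p, q}) : h ∈ Ideal.span {g₁, g₂} := by
  obtain ⟨u, v, rfl⟩ := Ideal.mem_span_pair.1 hc
  obtain ⟨w, hw⟩ : p ∣ a₁ - v * g₂ :=
    hpq.dvd_of_dvd_mul_left ⟨a₂ + u * g₂, by linear_combination ha⟩
  obtain ⟨t, ht⟩ : p ∣ b₁ + v * g₁ :=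
    hpq.dvd_of_dvd_mul_left ⟨b₂ - u * g₁, by linear_combination hb⟩
  refine Ideal.mem_span_pair.2 ⟨w, t, mul_left_cancel₀ hp ?_⟩
  linear_combination -h₁ - g₁ * hw - g₂ * ht

/-- If `p`, `q`, `s` is a regular sequence and each of them multiplies `h` into the ideal of a
relatively prime pair, then `h` lies in that ideal. -/
theorem IsRelPrime.mem_span_pair_of_mul_mem {g₁ g₂ p q s h : A} (hg : IsRelPrime g₁ g₂)
    (hg₂ : g₂ ≠ 0) (hpq : IsRelPrime p q) (hp : p ≠ 0)
    (hs : ∀ c, s * c ∈ Ideal.span {p, q} → c ∈ Ideal.span {p, q})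
    (h₁ : p * h ∈ Ideal.span {g₁, g₂}) (h₂ : q * h ∈ Ideal.span {g₁, g₂})
    (h₃ : s * h ∈ Ideal.span {g₁, g₂}) : h ∈ Ideal.span {g₁, g₂} := by
  obtain ⟨a₁, b₁, h₁⟩ := Ideal.mem_span_pair.1 h₁
  obtain ⟨a₂, b₂, h₂⟩ := Ideal.mem_span_pair.1 h₂
  obtain ⟨a₃, b₃, h₃⟩ := Ideal.mem_span_pair.1 h₃
  obtain ⟨c, hca, hcb⟩ := hg.exists_of_mul_add_mul_eq_zero (a := q * a₁ - p * a₂)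
    (b := q * b₁ - p * b₂) hg₂ (by linear_combination q * h₁ - p * h₂)
  obtain ⟨c₂, hca₂, -⟩ := hg.exists_of_mul_add_mul_eq_zero (a := s * a₂ - q * a₃)
    (b := s * b₂ - q * b₃) hg₂ (by linear_combination s * h₂ - q * h₃)
  obtain ⟨c₃, hca₃, -⟩ := hg.exists_of_mul_add_mul_eq_zero (a := p * a₃ - s * a₁)
    (b := p * b₃ - s * b₁) hg₂ (by linear_combination p * h₃ - s * h₁)
  refine hpq.mem_span_pair_of_koszul hp h₁.symm hca hcb (hs c ?_)
  refine Ideal.mem_span_pair.2 ⟨-c₂, -c₃, mul_right_cancel₀ hg₂ ?_⟩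
  linear_combination p * hca₂ + q * hca₃ + s * hca

end Koszul

namespace MvPolynomial

section Degree

variable {σ R : Type*} [CommSemiring R]

theorem homogeneousComponent_mul_of_isHomogeneous {g : MvPolynomial σ R} {r : ℕ}
    (hg : g.IsHomogeneous r) (m : ℕ) (c : MvPolynomial σ R) :
    homogeneousComponent (r + m) (c * g) = homogeneousComponent m c * g := by
  let := gradedAlgebra (σ := σ) (R := R)
  have h := DirectSum.coe_decompose_mul_of_right_mem_of_le (homogeneousSubmodule σ R) (a := c)
    (n := r + m) hg (Nat.le_add_right r m)
  rw [Nat.add_sub_cancel_left] at h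
  have hdec (n : ℕ) (p : MvPolynomial σ R) :
      (DirectSum.decompose (homogeneousSubmodule σ R) p n : MvPolynomial σ R) =
        homogeneousComponent n p := decomposition.decompose'_apply p n
  rwa [hdec, hdec] at h

end Degree

section Field

variable {σ K : Type*} [Field K]

variable (K) in
theorem two_mul_finrank_homogeneousSubmodule_fin_three (n : ℕ) :
    2 * Module.finrank K (homogeneousSubmodule (Fin 3) K n) = (n + 2) * (n + 1) := by
  have hspan : homogeneousSubmodule (Fin 3) K n =
      Submodule.span K (Set.range fun d : (Finset.univ : Finset (Fin 3)).finsuppAntidiag n =>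
        basisMonomials (Fin 3) K d.1) := by
    rw [homogeneousSubmodule_eq_finsupp_supported, AddMonoidAlgebra.supported_eq_span_single]
    congr 1
    ext p
    simp [Finset.mem_finsuppAntidiag, Finsupp.degree_eq_sum, single_eq_monomial]
  have hli := (basisMonomials (Fin 3) K).linearIndependent.comp
    (Subtype.val : (Finset.univ : Finset (Fin 3)).finsuppAntidiag n → _) Subtype.val_injective
  rw [hspan]
  erw [finrank_span_eq_card hli]
  rw [Fintype.card_coe, Finset.card_finsuppAntidiag_nat_eq_choose, Finset.card_fin,
    show 3 + n - 1 = n + 2 by omega, Nat.choose_symm_add, Nat.choose_two_right,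
    Nat.mul_div_cancel' (Nat.even_mul_pred_self _).two_dvd]
  rfl

theorem mem_span_X_pow_pair_of_X_pow_mul_mem {i j k : σ} (hik : i ≠ k) (hjk : j ≠ k) (N : ℕ)
    {c : MvPolynomial σ K}
    (hc : X k ^ N * c ∈ Ideal.span {(X i ^ N : MvPolynomial σ K), X j ^ N}) :
    c ∈ Ideal.span {(X i ^ N : MvPolynomial σ K), X j ^ N} := by
  classical
  have himage : ({X i ^ N, X j ^ N} : Set (MvPolynomial σ K)) =
      Set.image (fun s => monomial s (1 : K)) {Finsupp.single i N, Finsupp.single j N} := by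
    simp [Set.image_pair, X_pow_eq_monomial]
  rw [himage, mem_ideal_span_monomial_image] at hc ⊢
  intro d hd
  have hkd : Finsupp.single k N + d ∈ (X k ^ N * c).support := by
    rw [X_pow_eq_monomial, mem_support_iff, coeff_monomial_mul, one_mul]
    exact mem_support_iff.1 hd
  obtain ⟨s, hs, hsd⟩ := hc _ hkd
  refine ⟨s, hs, ?_⟩
  rcases hs with rfl | rfl
  · have := hsd i
    simp_all [Finsupp.single_le_iff]
  · have := hsd j
    simp_all [Finsupp.single_le_iff]

theorem isRelPrime_X {i j : σ} (hij : i ≠ j) :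
    IsRelPrime (X i : MvPolynomial σ K) (X j) := by
  refine (X_prime (i := i)).irreducible.isRelPrime_iff_not_dvd.2 fun h => ?_
  exact hij (X_dvd_X.1 h)

/-- The linear form vanishing at `y` given by the `2 × 2` minors on the coordinates `a`, `b`. -/
noncomputable def minorForm (y : σ → K) (a b : σ) : MvPolynomial σ K :=
  C (y b) * X a - C (y a) * X b

theorem isHomogeneous_minorForm (y : σ → K) (a b : σ) : (minorForm y a b).IsHomogeneous 1 :=
  (isHomogeneous_C_mul_X _ _).sub (isHomogeneous_C_mul_X _ _)

@[simp]
theorem eval_minorForm (y z : σ → K) (a b : σ) :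
    eval z (minorForm y a b) = y b * z a - y a * z b := by
  simp [minorForm]

theorem irreducible_minorForm {y : σ → K} {a b : σ} (hab : a ≠ b) (hb : y b ≠ 0) :
    Irreducible (minorForm y a b) := by
  classical
  have hcoeff : coeff (Finsupp.single a 1) (minorForm y a b) = y b := by
    simp [minorForm, coeff_C_mul, coeff_X, hab.symm, Finsupp.single_left_inj]
  have hne : minorForm y a b ≠ 0 := fun h => hb (by rw [← hcoeff, h, coeff_zero])
  refine irreducible_of_totalDegree_eq_one ((isHomogeneous_minorForm y a b).totalDegree hne)
    fun c hc => ?_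
  exact isUnit_of_dvd_unit (hc (Finsupp.single a 1)) (hcoeff ▸ hb.isUnit)

theorem exists_isRelPrime_linear_vanishing {y : Fin 3 → K} (hy : y ≠ 0) :
    ∃ p q : MvPolynomial (Fin 3) K, p.IsHomogeneous 1 ∧ q.IsHomogeneous 1 ∧
      eval y p = 0 ∧ eval y q = 0 ∧ IsRelPrime p q ∧ p ≠ 0 := by
  obtain ⟨b, hb⟩ := Function.ne_iff.1 hy
  obtain ⟨a, c, hab, hcb, hac⟩ : ∃ a c : Fin 3, a ≠ b ∧ c ≠ b ∧ a ≠ c := by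
    clear hb; revert b; decide
  have hirr := irreducible_minorForm hab hb
  refine ⟨minorForm y a b, minorForm y c b, isHomogeneous_minorForm _ _ _,
    isHomogeneous_minorForm _ _ _, by simp [mul_comm], by simp [mul_comm],
    hirr.isRelPrime_iff_not_dvd.2 fun ⟨t, ht⟩ => hb ?_, hirr.ne_zero⟩
  simpa [hab, hac, hcb.symm] using congrArg (eval (Pi.single c 1)) ht

theorem exists_linear_eval_ne_zero {y : σ → K} (hy : y ≠ 0) :
    ∃ p : MvPolynomial σ K, p.IsHomogeneous 1 ∧ eval y p ≠ 0 := by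
  obtain ⟨b, hb⟩ := Function.ne_iff.1 hy
  exact ⟨X b, isHomogeneous_X K b, by simpa using hb⟩

theorem exists_linear_separating {y z : σ → K} (hz : z ≠ 0) (hyz : ¬ ∃ c : K, y = c • z) :
    ∃ p : MvPolynomial σ K, p.IsHomogeneous 1 ∧ eval z p ≠ 0 ∧ eval y p = 0 := by
  obtain ⟨b, hb⟩ := Function.ne_iff.1 hz
  have hb : z b ≠ 0 := hb
  by_contra! hcon
  refine hyz ⟨y b / z b, _root_.funext fun a => ?_⟩
  have h : eval z (minorForm y a b) = 0 := by
    by_contra hne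
    exact hcon _ (isHomogeneous_minorForm y a b) hne (by simp [mul_comm])
  rw [eval_minorForm] at h
  rw [Pi.smul_apply, smul_eq_mul]
  field_simp
  linear_combination -h

/-- Evaluation of forms of degree `n` at a family of points. -/
noncomputable def evalForms {ι : Type*} (n : ℕ) (x : ι → σ → K) :
    homogeneousSubmodule σ K n →ₗ[K] ι → K :=
  LinearMap.pi fun i => (aeval (x i)).toLinearMap ∘ₗ (homogeneousSubmodule σ K n).subtype

@[simp]
theorem evalForms_apply {ι : Type*} (n : ℕ) (x : ι → σ → K) (f : homogeneousSubmodule σ K n)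
    (i : ι) : evalForms n x f i = eval (x i) f.1 := by
  simp [evalForms, aeval_eq_eval]

/-- Pairwise distinct projective points impose independent conditions on forms of degree at least
the number of points. -/
theorem evalForms_surjective {ι : Type*} [Fintype ι] {n : ℕ} (hn : Fintype.card ι ≤ n)
    {x : ι → σ → K} (hx0 : ∀ i, x i ≠ 0) (hx : ∀ i j, i ≠ j → ¬ ∃ c : K, x j = c • x i) :
    Function.Surjective (evalForms n x) := by
  classical
  have hsep : ∀ i j, ∃ p : MvPolynomial σ K, p.IsHomogeneous 1 ∧ eval (x i) p ≠ 0 ∧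
      (i ≠ j → eval (x j) p = 0) := fun i j => by
    by_cases hij : i = j
    · obtain ⟨p, hp, hpi⟩ := exists_linear_eval_ne_zero (hx0 i)
      exact ⟨p, hp, hpi, fun h => absurd hij h⟩
    · obtain ⟨p, hp, hpi, hpj⟩ := exists_linear_separating (hx0 i) (hx i j hij)
      exact ⟨p, hp, hpi, fun _ => hpj⟩
  choose L hL hLi hLj using hsep
  have hP : ∀ i, ((∏ j, L i j) * L i i ^ (n - Fintype.card ι)).IsHomogeneous n := fun i => by
    have h := (IsHomogeneous.prod Finset.univ (L i) (fun _ => 1) fun j _ => hL i j).mul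
      ((hL i i).pow (n - Fintype.card ι))
    convert h using 1
    simp
    omega
  rw [← LinearMap.range_eq_top, eq_top_iff, ← (Pi.basisFun K ι).span_eq, Submodule.span_le]
  rintro _ ⟨i, rfl⟩
  set P := (∏ j, L i j) * L i i ^ (n - Fintype.card ι) with hPdef
  have hPi : eval (x i) P ≠ 0 := by
    simp [hPdef, Finset.prod_ne_zero_iff, hLi]
  refine ⟨(eval (x i) P)⁻¹ • ⟨P, hP i⟩, _root_.funext fun j => ?_⟩
  by_cases hij : i = j
  · subst hij
    simp [hPi]
  · have hPj : eval (x j) P = 0 := by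
      rw [hPdef, map_mul, eval_prod, Finset.prod_eq_zero (Finset.mem_univ j) (hLj i j hij),
        zero_mul]
    simp [hPj, hij, Ne.symm]

/-- Multiplication by a form of degree `m`, on forms of degree `n`. -/
noncomputable def mulForm {g : MvPolynomial σ K} {m : ℕ} (hg : g.IsHomogeneous m) (n : ℕ) :
    homogeneousSubmodule σ K n →ₗ[K] homogeneousSubmodule σ K (n + m) :=
  (LinearMap.mulRight K g).restrict fun _ hf => IsHomogeneous.mul hf hg

@[simp]
theorem coe_mulForm {g : MvPolynomial σ K} {m : ℕ} (hg : g.IsHomogeneous m) (n : ℕ)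
    (f : homogeneousSubmodule σ K n) : (mulForm hg n f : MvPolynomial σ K) = f.1 * g :=
  rfl

instance finite_homogeneousSubmodule [Finite σ] (n : ℕ) :
    Module.Finite K (homogeneousSubmodule σ K n) :=
  Module.Finite.iff_fg.2 (homogeneousSubmodule_fg σ K n)

theorem finrank_ker_coprod_mulForm_le [Finite σ] {g₁ g₂ : MvPolynomial σ K} {r : ℕ}
    (hg₁ : g₁.IsHomogeneous r) (hg₂ : g₂.IsHomogeneous r) (hg : IsRelPrime g₁ g₂) (h0 : g₂ ≠ 0)
    (k : ℕ) :
    Module.finrank K (LinearMap.ker ((mulForm hg₁ (k + r)).coprod (mulForm hg₂ (k + r)))) ≤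
      Module.finrank K (homogeneousSubmodule σ K k) := by
  refine le_trans (Submodule.finrank_mono ?_)
    (LinearMap.finrank_range_le ((mulForm hg₂ k).prod (-mulForm hg₁ k)))
  rintro ⟨a, b⟩ hab
  have hab : a.1 * g₁ + b.1 * g₂ = 0 := congrArg Subtype.val (LinearMap.mem_ker.1 hab)
  obtain ⟨c, hca, hcb⟩ := hg.exists_of_mul_add_mul_eq_zero h0 hab
  have ha : homogeneousComponent k c * g₂ = a.1 := by
    rw [← homogeneousComponent_mul_of_isHomogeneous hg₂, ← hca,
      homogeneousComponent_eq_self (add_comm k r ▸ (mem_homogeneousSubmodule _ _).1 a.2)]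
  refine ⟨⟨homogeneousComponent k c, homogeneousComponent_isHomogeneous k c⟩,
    Prod.ext (Subtype.ext ha) (Subtype.ext (mul_right_cancel₀ h0 ?_))⟩
  change -(homogeneousComponent k c * g₁) * g₂ = b.1 * g₂
  linear_combination -hab - g₁ * ha

/-- In large degrees, the forms vanishing on the `r ^ 2` common zeros of two relatively prime forms
of degree `r` lie in the ideal generated by these forms. -/
theorem mem_span_pair_of_eval_eq_zero_of_le {g₁ g₂ : MvPolynomial (Fin 3) K} {r : ℕ}
    (hg₁ : g₁.IsHomogeneous r) (hg₂ : g₂.IsHomogeneous r) (hg : IsRelPrime g₁ g₂) (h0 : g₂ ≠ 0)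
    {x : Fin (r ^ 2) → Fin 3 → K} (hx0 : ∀ i, x i ≠ 0)
    (hxz : ∀ i, eval (x i) g₁ = 0 ∧ eval (x i) g₂ = 0)
    (hx : ∀ i j, i ≠ j → ¬ ∃ c : K, x j = c • x i) {k : ℕ} (hk : r ^ 2 ≤ k)
    {h : MvPolynomial (Fin 3) K} (hh : h.IsHomogeneous (k + r + r))
    (hhx : ∀ i, eval (x i) h = 0) : h ∈ Ideal.span {g₁, g₂} := by
  set φ := (mulForm hg₁ (k + r)).coprod (mulForm hg₂ (k + r)) with hφ
  have hle : LinearMap.range φ ≤ LinearMap.ker (evalForms (k + r + r) x) := by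
    rintro _ ⟨⟨a, b⟩, rfl⟩
    refine LinearMap.mem_ker.2 (_root_.funext fun i => ?_)
    simp [hφ, hxz]
  have hsurj := evalForms_surjective (n := k + r + r) (by simp; omega) hx0 hx
  have hdim : Module.finrank K (LinearMap.ker (evalForms (k + r + r) x)) ≤
      Module.finrank K (LinearMap.range φ) := by
    have h₁ := (evalForms (k + r + r) x).finrank_range_add_finrank_ker
    rw [LinearMap.range_eq_top.2 hsurj, finrank_top, Module.finrank_fin_fun] at h₁
    have h₂ := φ.finrank_range_add_finrank_ker
    rw [Module.finrank_prod] at h₂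
    have h₃ := finrank_ker_coprod_mulForm_le hg₁ hg₂ hg h0 k
    rw [← hφ] at h₃
    have e₁ := two_mul_finrank_homogeneousSubmodule_fin_three K (k + r + r)
    have e₂ := two_mul_finrank_homogeneousSubmodule_fin_three K (k + r)
    have e₃ := two_mul_finrank_homogeneousSubmodule_fin_three K k
    nlinarith
  have hmem : (⟨h, hh⟩ : homogeneousSubmodule (Fin 3) K (k + r + r)) ∈ LinearMap.range φ := by
    rw [Submodule.eq_of_le_of_finrank_le hle hdim]
    exact LinearMap.mem_ker.2 (_root_.funext fun i => by simp [hhx])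
  obtain ⟨⟨a, b⟩, hab⟩ := hmem
  exact Ideal.mem_span_pair.2 ⟨a.1, b.1, congrArg Subtype.val hab⟩

theorem mem_span_pair_of_eval_eq_zero {g₁ g₂ : MvPolynomial (Fin 3) K} {r : ℕ}
    (hg₁ : g₁.IsHomogeneous r) (hg₂ : g₂.IsHomogeneous r) (hg : IsRelPrime g₁ g₂) (h0 : g₂ ≠ 0)
    {x : Fin (r ^ 2) → Fin 3 → K} (hx0 : ∀ i, x i ≠ 0)
    (hxz : ∀ i, eval (x i) g₁ = 0 ∧ eval (x i) g₂ = 0)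
    (hx : ∀ i j, i ≠ j → ¬ ∃ c : K, x j = c • x i)
    {h : MvPolynomial (Fin 3) K} {e : ℕ} (hh : h.IsHomogeneous e)
    (hhx : ∀ i, eval (x i) h = 0) : h ∈ Ideal.span {g₁, g₂} := by
  have hmem : ∀ i, X i ^ (r ^ 2 + r + r) * h ∈ Ideal.span {g₁, g₂} := fun i => by
    refine mem_span_pair_of_eval_eq_zero_of_le hg₁ hg₂ hg h0 hx0 hxz hx (k := r ^ 2 + e)
      (Nat.le_add_right _ _) ?_ fun j => by rw [map_mul, hhx, mul_zero]
    convert (isHomogeneous_X_pow i (r ^ 2 + r + r)).mul hh using 1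
    ring
  exact hg.mem_span_pair_of_mul_mem h0 (isRelPrime_X (i := 0) (j := 1) (by decide)).pow
    (pow_ne_zero _ (X_ne_zero _))
    (fun c => mem_span_X_pow_pair_of_X_pow_mul_mem (by decide) (by decide) _)
    (hmem 0) (hmem 1) (hmem 2)

/-- A form in an ideal generated by two forms of degree `r` has homogeneous coefficients. -/
theorem IsHomogeneous.exists_of_mem_span_pair {g₁ g₂ h : MvPolynomial σ K} {r m : ℕ}
    (hg₁ : g₁.IsHomogeneous r) (hg₂ : g₂.IsHomogeneous r) (hh : h.IsHomogeneous (r + m))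
    (hmem : h ∈ Ideal.span {g₁, g₂}) :
    ∃ a b : MvPolynomial σ K, a.IsHomogeneous m ∧ b.IsHomogeneous m ∧ h = a * g₁ + b * g₂ := by
  obtain ⟨a, b, hab⟩ := Ideal.mem_span_pair.1 hmem
  refine ⟨_, _, homogeneousComponent_isHomogeneous m a, homogeneousComponent_isHomogeneous m b, ?_⟩
  rw [← homogeneousComponent_mul_of_isHomogeneous hg₁,
    ← homogeneousComponent_mul_of_isHomogeneous hg₂, ← map_add, hab,
    homogeneousComponent_eq_self hh]

/-- The quotient by two relatively prime forms of degree `r` has no socle below degree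
`2 * r - 2`. -/
theorem mem_span_pair_of_linear_mul_mem {g₁ g₂ p q f : MvPolynomial σ K} {s : ℕ}
    (hg₁ : g₁.IsHomogeneous (s + 2)) (hg₂ : g₂.IsHomogeneous (s + 2)) (hg : IsRelPrime g₁ g₂)
    (h0 : g₂ ≠ 0) (hp : p.IsHomogeneous 1) (hq : q.IsHomogeneous 1) (hpq : IsRelPrime p q)
    (hp0 : p ≠ 0) (hf : f.IsHomogeneous (2 * s + 1))
    (hpf : p * f ∈ Ideal.span {g₁, g₂}) (hqf : q * f ∈ Ideal.span {g₁, g₂}) :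
    f ∈ Ideal.span {g₁, g₂} := by
  have hdeg : 1 + (2 * s + 1) = s + 2 + s := by ring
  obtain ⟨a₁, b₁, ha₁, -, h₁⟩ :=
    IsHomogeneous.exists_of_mem_span_pair hg₁ hg₂ (hdeg ▸ hp.mul hf) hpf
  obtain ⟨a₂, b₂, ha₂, -, h₂⟩ :=
    IsHomogeneous.exists_of_mem_span_pair hg₁ hg₂ (hdeg ▸ hq.mul hf) hqf
  obtain ⟨c, hca, hcb⟩ := hg.exists_of_mul_add_mul_eq_zero (a := q * a₁ - p * a₂)
    (b := q * b₁ - p * b₂) h0 (by linear_combination p * h₂ - q * h₁)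
  have hc : c = 0 := by
    by_contra hc
    have hle := ((hq.mul ha₁).sub (hp.mul ha₂)).totalDegree_le
    rw [hca, totalDegree_mul_of_isDomain hc h0, hg₂.totalDegree h0] at hle
    omega
  exact hpq.mem_span_pair_of_koszul hp0 h₁ hca hcb (hc ▸ Submodule.zero_mem _)

end Field

end MvPolynomial


/-- **Cayley–Bacharach in the plane.** Let `K` be algebraically closed and
`r ≥ 3`. If two homogeneous polynomials `g₁, g₂` of degree `r` in `K[X,Y,Z]` have no common
irreducible factor and their common projective zero set consists of exactly `r²` distinct
points, then every homogeneous polynomial of degree at most `2r − 3` vanishing at `r² − 1`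
of those points vanishes at all of them. -/
theorem stmt8 (K : Type*) [Field K] [IsAlgClosed K] (r : ℕ) (hr : 3 ≤ r)
    (g₁ g₂ : MvPolynomial (Fin 3) K)
    (hg₁ : g₁.IsHomogeneous r) (hg₂ : g₂.IsHomogeneous r)
    (hcop : ¬ ∃ p : MvPolynomial (Fin 3) K, Irreducible p ∧ p ∣ g₁ ∧ p ∣ g₂)
    -- representatives of the r² common projective zeros
    (x : Fin (r ^ 2) → Fin 3 → K)
    (hx0 : ∀ i, x i ≠ 0)
    (hxz : ∀ i, MvPolynomial.eval (x i) g₁ = 0 ∧ MvPolynomial.eval (x i) g₂ = 0)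
    -- the points are pairwise distinct as projective points
    (hxdist : ∀ i j, i ≠ j → ¬ ∃ c : K, x j = c • x i)
    -- every common projective zero is one of these points
    (hxall : ∀ y : Fin 3 → K, y ≠ 0 → MvPolynomial.eval y g₁ = 0 →
      MvPolynomial.eval y g₂ = 0 → ∃ i, ∃ c : K, y = c • x i)
    (f : MvPolynomial (Fin 3) K) (d : ℕ) (hf : f.IsHomogeneous d) (hd : d ≤ 2 * r - 3)
    (i₀ : Fin (r ^ 2)) (hvan : ∀ i, i ≠ i₀ → MvPolynomial.eval (x i) f = 0) :
    ∀ i, MvPolynomial.eval (x i) f = 0 := by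
  have hxz₀ := hxz i₀
  have hg : IsRelPrime g₁ g₂ := fun d h₁ h₂ => by
    by_contra hd
    by_cases hd0 : d = 0
    · subst hd0
      rw [zero_dvd_iff] at h₁ h₂
      exact hcop ⟨MvPolynomial.X 0, MvPolynomial.X_prime.irreducible, by simp [h₁],
        by simp [h₂]⟩
    · obtain ⟨p, hp, hpd⟩ := WfDvdMonoid.exists_irreducible_factor hd hd0
      exact hcop ⟨p, hp, hpd.trans h₁, hpd.trans h₂⟩
  have h0 : g₂ ≠ 0 := by
    rintro rfl
    have hunit := (isRelPrime_zero_right.1 hg).map (MvPolynomial.eval (x i₀))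
    simp [hxz₀.1] at hunit
  obtain ⟨s, rfl⟩ : ∃ s, r = s + 2 := ⟨r - 2, by omega⟩
  obtain ⟨ℓ, hℓ, hℓx⟩ := MvPolynomial.exists_linear_eval_ne_zero (hx0 i₀)
  obtain ⟨p, q, hp, hq, hpx, hqx, hpq, hp0⟩ :=
    MvPolynomial.exists_isRelPrime_linear_vanishing (hx0 i₀)
  set F := ℓ ^ (2 * s + 1 - d) * f with hFdef
  have hF : F.IsHomogeneous (2 * s + 1) := by
    convert (hℓ.pow (2 * s + 1 - d)).mul hf using 1
    omega
  have hmul : ∀ m : MvPolynomial (Fin 3) K, m.IsHomogeneous 1 →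
      MvPolynomial.eval (x i₀) m = 0 → m * F ∈ Ideal.span {g₁, g₂} := fun m hm hmx => by
    refine MvPolynomial.mem_span_pair_of_eval_eq_zero hg₁ hg₂ hg h0 hx0 hxz hxdist (hm.mul hF)
      fun i => ?_
    by_cases hi : i = i₀
    · rw [hi, map_mul, hmx, zero_mul]
    · rw [hFdef, map_mul, map_mul, hvan i hi, mul_zero, mul_zero]
  obtain ⟨a, b, hab⟩ := Ideal.mem_span_pair.1 <|
    MvPolynomial.mem_span_pair_of_linear_mul_mem hg₁ hg₂ hg h0 hp hq hpq hp0 hF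
      (hmul p hp hpx) (hmul q hq hqx)
  have hFx : MvPolynomial.eval (x i₀) F = 0 := by
    rw [← hab, map_add, map_mul, map_mul, hxz₀.1, hxz₀.2, mul_zero, mul_zero, add_zero]
  rw [hFdef, map_mul, map_pow] at hFx
  have hfx := (mul_eq_zero.1 hFx).resolve_left (pow_ne_zero _ hℓx)
  intro i
  by_cases hi : i = i₀
  · rw [hi, hfx]
  · exact hvan i hi
end

section
/- (Degree budget lemma.) Let K be an algebraically closed field and let r ≥ 3. Let g₁, g₂ ∈ K[X, Y, Z] be homogeneous of degree r with no common irreducible factor, and suppose that the set X of common projective zeros of g₁ and g₂ consists of exactly r² distinct projective points. Let h ∈ K[X, Y, Z] be homogeneous of degree d, let t ≥ 1, and suppose d + (t − 1) ≤ 2r − 3. Then it is impossible that h vanishes at exactly r² − t points of X and fails to vanish at exactly t points of X. -/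
namespace MvPolynomial

/-- The degree `n` part of a multiple of a homogeneous polynomial `g` is a homogeneous multiple
of `g`. -/
lemma exists_homogeneousComponent_mul {σ R : Type*} [CommRing R] {g : MvPolynomial σ R} {k : ℕ}
    (hg : g.IsHomogeneous k) (a : MvPolynomial σ R) (n : ℕ) :
    ∃ b : MvPolynomial σ R, b.IsHomogeneous (n - k) ∧ homogeneousComponent n (a * g) = b * g := by
  have hterm : ∀ i, ∃ b : MvPolynomial σ R, b.IsHomogeneous (n - k) ∧
      homogeneousComponent n (homogeneousComponent i a * g) = b * g := by
    intro i
    rw [homogeneousComponent_of_mem ((homogeneousComponent_isHomogeneous i a).mul hg)]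
    split_ifs with h
    · refine ⟨_, ?_, rfl⟩
      rw [h, Nat.add_sub_cancel]
      exact homogeneousComponent_isHomogeneous i a
    · exact ⟨0, isHomogeneous_zero _ _ _, (zero_mul g).symm⟩
  choose b hb hbg using hterm
  refine ⟨∑ i ∈ Finset.range (a.totalDegree + 1), b i, IsHomogeneous.sum _ _ _ fun i _ => hb i, ?_⟩
  conv_lhs => rw [← sum_homogeneousComponent a, Finset.sum_mul, map_sum]
  simp only [hbg, Finset.sum_mul]

/-- A homogeneous element of the ideal `(u, v)` is a combination with homogeneous coefficients. -/
lemma IsHomogeneous.exists_eq_mul_add_mul {σ R : Type*} [CommRing R]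
    {f u v a b : MvPolynomial σ R} {n k : ℕ} (hf : f.IsHomogeneous n) (hu : u.IsHomogeneous k)
    (hv : v.IsHomogeneous k) (h : f = a * u + b * v) :
    ∃ a' b' : MvPolynomial σ R, a'.IsHomogeneous (n - k) ∧ b'.IsHomogeneous (n - k) ∧
      f = a' * u + b' * v := by
  obtain ⟨a', ha', ha⟩ := exists_homogeneousComponent_mul hu a n
  obtain ⟨b', hb', hb⟩ := exists_homogeneousComponent_mul hv b n
  refine ⟨a', b', ha', hb', ?_⟩
  rw [← ha, ← hb, ← map_add, ← h, homogeneousComponent_eq_self hf]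

/-- Syzygies of a relatively prime pair are multiples of the trivial one. -/
lemma exists_of_mul_add_mul_eq_zero {R : Type*} [CommRing R] [IsDomain R] [DecompositionMonoid R]
    {u v a b : R} (huv : IsRelPrime u v) (hv : v ≠ 0) (h : a * u + b * v = 0) :
    ∃ c, a = c * v ∧ b = -c * u := by
  have hdvd : v ∣ a := huv.symm.dvd_of_dvd_mul_right ⟨-b, by linear_combination h⟩
  obtain ⟨c, rfl⟩ := hdvd
  exact ⟨c, mul_comm _ _, mul_left_cancel₀ hv (by linear_combination h)⟩

lemma IsHomogeneous.not_isUnit {σ K : Type*} [Field K] {f : MvPolynomial σ K} {n : ℕ}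
    (hf : f.IsHomogeneous n) (hn : n ≠ 0) : ¬ IsUnit f := by
  intro h
  refine (h.map (constantCoeff (σ := σ) (R := K))).ne_zero ?_
  rw [constantCoeff_eq]
  exact hf.coeff_eq_zero (by simpa using hn.symm)

lemma IsHomogeneous.ne_zero_of_isRelPrime {σ K : Type*} [Field K] {u v : MvPolynomial σ K} {n : ℕ}
    (hu : u.IsHomogeneous n) (hn : n ≠ 0) (huv : IsRelPrime u v) : v ≠ 0 := by
  rintro rfl
  exact hu.not_isUnit hn (isRelPrime_zero_right.1 huv)

lemma finrank_homogeneousSubmodule_fin_three (K : Type*) [Field K] (n : ℕ) :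
    Module.finrank K (homogeneousSubmodule (Fin 3) K n) = (n + 2).choose 2 := by
  have hset : {d : Fin 3 →₀ ℕ | d.degree = n} =
      ((Finset.univ : Finset (Fin 3)).finsuppAntidiag n : Set (Fin 3 →₀ ℕ)) := by
    ext d
    simp [Finsupp.degree_eq_sum]
  rw [homogeneousSubmodule_eq_finsupp_supported, hset,
    (AddMonoidAlgebra.supportedEquivFinsupp _).finrank_eq, Module.finrank_finsupp_self]
  simp only [Finset.coe_sort_coe, Fintype.card_coe, Finset.card_finsuppAntidiag_nat_eq_choose]
  rw [← Nat.choose_symm_add]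
  simp [add_comm]

instance finiteDimensional_homogeneousSubmodule {σ K : Type*} [Finite σ] [Field K] (n : ℕ) :
    FiniteDimensional K (homogeneousSubmodule σ K n) :=
  Module.Finite.iff_fg.2 (homogeneousSubmodule_fg σ K n)

/-- The linear form on `K ^ n` given by a dual vector. -/
noncomputable def ofDual {K : Type*} [Field K] {n : ℕ} (f : Module.Dual K (Fin n → K)) :
    MvPolynomial (Fin n) K :=
  ∑ i, C (f (Pi.single i 1)) * X i

lemma isHomogeneous_ofDual {K : Type*} [Field K] {n : ℕ} (f : Module.Dual K (Fin n → K)) :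
    (ofDual f).IsHomogeneous 1 :=
  IsHomogeneous.sum _ _ _ fun _ _ => isHomogeneous_C_mul_X _ _

@[simp]
lemma eval_ofDual {K : Type*} [Field K] {n : ℕ} (f : Module.Dual K (Fin n → K)) (x : Fin n → K) :
    eval x (ofDual f) = f x := by
  conv_rhs => rw [pi_eq_sum_univ' x]
  simp [ofDual, map_sum, mul_comm]

/-- A product of linear forms vanishing at all `x j` with `j ∈ s`, but not at `x i`. -/
lemma exists_isHomogeneous_card_eval_ne_zero {K ι : Type*} [Field K] {n : ℕ} {x : ι → Fin n → K}
    (hx : ∀ i j, i ≠ j → ¬ ∃ c : K, x j = c • x i) {i : ι} {s : Finset ι} (hi : i ∉ s) :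
    ∃ p : MvPolynomial (Fin n) K, p.IsHomogeneous s.card ∧ eval (x i) p ≠ 0 ∧
      ∀ j ∈ s, eval (x j) p = 0 := by
  have hsep : ∀ j, j ≠ i → ∃ f : Module.Dual K (Fin n → K), f (x i) ≠ 0 ∧ f (x j) = 0 := by
    intro j hj
    have hmem : x i ∉ Submodule.span K {x j} := fun h => by
      obtain ⟨c, hc⟩ := Submodule.mem_span_singleton.1 h
      exact hx j i hj ⟨c, hc.symm⟩
    obtain ⟨f, hf, hker⟩ := Submodule.exists_le_ker_of_notMem hmem
    exact ⟨f, hf, hker (Submodule.mem_span_singleton_self _)⟩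
  choose! f hfi hfj using hsep
  refine ⟨∏ j ∈ s, ofDual (f j), ?_, ?_, fun j hj => ?_⟩
  · simpa using IsHomogeneous.prod s (fun j => ofDual (f j)) (fun _ => 1)
      fun j _ => isHomogeneous_ofDual _
  · rw [map_prod]
    exact Finset.prod_ne_zero_iff.2 fun j hj => by
      simpa using hfi j (ne_of_mem_of_not_mem hj hi)
  · rw [map_prod]
    exact Finset.prod_eq_zero hj (by simpa using hfj j (ne_of_mem_of_not_mem hj hi))

/-- Restriction to the plane `ofDual f = 0`, as an endomorphism of `K[X, Y, Z]` fixing the second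
and third variable. -/
lemma exists_restriction {K : Type*} [Field K] {f : Module.Dual K (Fin 3 → K)}
    (hf : f (Pi.single 0 1) ≠ 0) :
    ∃ φ : MvPolynomial (Fin 3) K →ₐ[K] MvPolynomial (Fin 3) K, φ (ofDual f) = 0 ∧
      (∀ i, i ≠ 0 → φ (X i) = X i) ∧ (∀ p, ofDual f ∣ p - φ p) ∧
      ∀ p n, p.IsHomogeneous n → (φ p).IsHomogeneous n := by
  have hC : (C (f (Pi.single 0 1))⁻¹ * C (f (Pi.single 0 1)) : MvPolynomial (Fin 3) K) = 1 := by
    rw [← C_mul, inv_mul_cancel₀ hf, C_1]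
  let φ : MvPolynomial (Fin 3) K →ₐ[K] MvPolynomial (Fin 3) K :=
    aeval fun i => if i = 0 then X 0 - C (f (Pi.single 0 1))⁻¹ * ofDual f else X i
  have hφC : ∀ a : K, φ (C a) = C a := fun a => φ.commutes a
  have hφ0 : φ (X 0) = X 0 - C (f (Pi.single 0 1))⁻¹ * ofDual f := by simp [φ]
  have hφX : ∀ i, i ≠ 0 → φ (X i) = X i := fun i hi => by simp [φ, hi]
  refine ⟨φ, ?_, hφX, fun p => ?_, fun p n hp => ?_⟩
  · have he : ofDual f = C (f (Pi.single 0 1)) * X 0 + C (f (Pi.single 1 1)) * X 1 +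
        C (f (Pi.single 2 1)) * X 2 := by simp [ofDual, Fin.sum_univ_three]
    have h := congrArg φ he
    simp only [map_add, map_mul, hφC, hφ0, hφX 1 (by decide), hφX 2 (by decide)] at h
    linear_combination h - he - ofDual f * hC
  · induction p using MvPolynomial.induction_on with
    | C a => simp [hφC]
    | add p q hp hq =>
      have := dvd_add hp hq
      rwa [map_add, add_sub_add_comm]
    | mul_X p i hp =>
      have hX : ofDual f ∣ X i - φ (X i) := by
        by_cases hi : i = 0
        · subst hi
          rw [hφ0]
          exact ⟨C (f (Pi.single 0 1))⁻¹, by ring⟩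
        · simp [hφX i hi]
      have := dvd_add (hp.mul_right (X i)) (hX.mul_left (φ p))
      rw [map_mul]
      convert this using 1
      ring
  · rw [← one_mul n]
    refine hp.aeval _ fun i => ?_
    split_ifs
    · exact (isHomogeneous_X _ _).sub ((isHomogeneous_ofDual f).C_mul _)
    · exact isHomogeneous_X _ _

/-- If `u`, `v` and a linear form have no common projective zero, then the restrictions of `u` and
`v` to the plane are relatively prime. -/
lemma isRelPrime_restriction {K : Type*} [Field K] [IsAlgClosed K] {u v ℓ : MvPolynomial (Fin 3) K}
    (h : ∀ y, eval y u = 0 → eval y v = 0 → eval y ℓ = 0 → y = 0)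
    {φ : MvPolynomial (Fin 3) K →ₐ[K] MvPolynomial (Fin 3) K} (hφℓ : φ ℓ = 0)
    (hφX : ∀ i, i ≠ 0 → φ (X i) = X i) : IsRelPrime (φ u) (φ v) := by
  have hpow : ∀ i, i ≠ 0 → ∃ N : ℕ, ∀ p, p ∣ φ u → p ∣ φ v → p ∣ (X i) ^ N := by
    intro i hi
    have hrad : (X i : MvPolynomial (Fin 3) K) ∈ (Ideal.span {u, v, ℓ}).radical := by
      rw [← vanishingIdeal_zeroLocus_eq_radical (K := K), mem_vanishingIdeal_iff]
      intro y hy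
      rw [zeroLocus_span] at hy
      have hy0 : y = 0 := h y (hy u (by simp)) (hy v (by simp)) (hy ℓ (by simp))
      simp [hy0]
    obtain ⟨N, hN⟩ := hrad
    obtain ⟨a, b, c, habc⟩ : ∃ a b c, X i ^ N = a * u + b * v + c * ℓ := by
      obtain ⟨a, z, hz, hza⟩ := Ideal.mem_span_insert.1 hN
      obtain ⟨b, c, hbc⟩ := Ideal.mem_span_pair.1 hz
      exact ⟨a, b, c, by rw [hza, ← hbc, add_assoc]⟩
    refine ⟨N, fun p hu hv => ?_⟩
    have := congrArg φ habc
    simp only [map_add, map_mul, map_pow, hφX i hi, hφℓ, mul_zero, add_zero] at this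
    rw [this]
    exact dvd_add (hu.mul_left _) (hv.mul_left _)
  intro p hu hv
  obtain ⟨N, hN⟩ := hpow 1 (by decide)
  obtain ⟨M, hM⟩ := hpow 2 (by decide)
  have hcop : IsRelPrime (X 1 ^ N : MvPolynomial (Fin 3) K) (X 2 ^ M) := by
    refine IsRelPrime.pow ((X_prime (i := (1 : Fin 3))).irreducible.isRelPrime_iff_not_dvd.2 ?_)
    rw [X_dvd_X]
    simp
  exact hcop (hN p hu hv) (hM p hu hv)

/-- A form `ℓ` is regular modulo `(u, v)` when `u`, `v` are relatively prime modulo `ℓ`. -/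
lemma exists_eq_of_mul_eq {R : Type*} [CommRing R] [IsDomain R] [DecompositionMonoid R]
    {u v ℓ f a b : R} {φ : R →+* R} (hℓ : ℓ ≠ 0) (hφℓ : φ ℓ = 0) (hφ : ∀ p, ℓ ∣ p - φ p)
    (huv : IsRelPrime (φ u) (φ v)) (hv : φ v ≠ 0) (h : ℓ * f = a * u + b * v) :
    ∃ a' b', f = a' * u + b' * v := by
  have h0 : φ a * φ u + φ b * φ v = 0 := by
    rw [← map_mul, ← map_mul, ← map_add, ← h, map_mul, hφℓ, zero_mul]
  obtain ⟨c, hca, hcb⟩ := exists_of_mul_add_mul_eq_zero huv hv h0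
  obtain ⟨a', ha⟩ := hφ a
  obtain ⟨b', hb⟩ := hφ b
  obtain ⟨u', hu⟩ := hφ u
  obtain ⟨v', hv'⟩ := hφ v
  refine ⟨a' - c * v', b' + c * u', mul_left_cancel₀ hℓ ?_⟩
  linear_combination h + u * ha + v * hb + u * hca + v * hcb - c * u * hv' + c * v * hu

/-- In low degree, a form `f` whose multiples by all forms in two coordinates lie in `(u, v)` modulo
a linear form lies itself in `(u, v)` modulo this linear form. -/
lemma exists_eq_of_X_mul_eq {K : Type*} [Field K] {u v ℓ f : MvPolynomial (Fin 3) K} {e r : ℕ}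
    (hf : f.IsHomogeneous e) (hu : u.IsHomogeneous r) (hv : v.IsHomogeneous r)
    (hr : 2 ≤ r) (he : e + 3 ≤ 2 * r)
    {φ : MvPolynomial (Fin 3) K →ₐ[K] MvPolynomial (Fin 3) K} (hφℓ : φ ℓ = 0)
    (hφX : ∀ i, i ≠ 0 → φ (X i) = X i) (hφ : ∀ p, ℓ ∣ p - φ p)
    (hφh : ∀ p n, p.IsHomogeneous n → (φ p).IsHomogeneous n)
    (huv : IsRelPrime (φ u) (φ v))
    (h : ∀ i, i ≠ 0 → ∃ a b c, X i * f = a * u + b * v + c * ℓ) :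
    ∃ a b c, f = a * u + b * v + c * ℓ := by
  have hv0 : φ v ≠ 0 := (hφh u r hu).ne_zero_of_isRelPrime (by omega) huv
  have hX : ∀ i, i ≠ 0 → ∃ a b : MvPolynomial (Fin 3) K, a.IsHomogeneous (e + 1 - r) ∧
      b.IsHomogeneous (e + 1 - r) ∧ X i * φ f = a * φ u + b * φ v := by
    intro i hi
    obtain ⟨a, b, c, habc⟩ := h i hi
    have habc' := congrArg φ habc
    simp only [map_add, map_mul, hφX i hi, hφℓ, mul_zero, add_zero] at habc'
    refine IsHomogeneous.exists_eq_mul_add_mul ?_ (hφh u r hu) (hφh v r hv) habc'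
    rw [add_comm e]
    exact (isHomogeneous_X K i).mul (hφh f e hf)
  obtain ⟨a, b, ha, hb, hab⟩ := hX 1 (by decide)
  obtain ⟨c, d, hc, hd, hcd⟩ := hX 2 (by decide)
  obtain ⟨q, hq, -⟩ := exists_of_mul_add_mul_eq_zero (a := X 2 * a - X 1 * c)
    (b := X 2 * b - X 1 * d) huv hv0 (by linear_combination X 1 * hcd - X 2 * hab)
  have hdeg : (X 2 * a - X 1 * c).IsHomogeneous (1 + (e + 1 - r)) :=
    ((isHomogeneous_X K 2).mul ha).sub ((isHomogeneous_X K 1).mul hc)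
  have hq0 : q = 0 := by
    by_contra hq0
    have h1 := hdeg.totalDegree_le
    rw [hq, totalDegree_mul_of_isDomain hq0 hv0, (hφh v r hv).totalDegree hv0] at h1
    omega
  rw [hq0, zero_mul] at hq
  have h12 : ¬ (X 1 : MvPolynomial (Fin 3) K) ∣ X 2 := by rw [X_dvd_X]; simp
  have hdvd : ∀ p p' : MvPolynomial (Fin 3) K, X 2 * p - X 1 * p' = 0 → X 1 ∣ p := by
    intro p p' hp
    exact ((X_prime (i := (1 : Fin 3))).dvd_or_dvd (a := X 2) ⟨p', by linear_combination hp⟩).resolve_left h12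
  obtain ⟨a', rfl⟩ := hdvd a c hq
  have hq' : X 2 * b - X 1 * d = 0 := by
    refine mul_right_cancel₀ hv0 ?_
    linear_combination X 1 * hcd - X 2 * hab - φ u * hq
  obtain ⟨b', rfl⟩ := hdvd b d hq'
  have hf' : φ f = a' * φ u + b' * φ v :=
    mul_left_cancel₀ (X_ne_zero (R := K) (1 : Fin 3)) (by linear_combination hab)
  obtain ⟨f₁, hf₁⟩ := hφ f
  obtain ⟨u₁, hu₁⟩ := hφ u
  obtain ⟨v₁, hv₁⟩ := hφ v
  exact ⟨a', b', f₁ - a' * u₁ - b' * v₁, by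
    linear_combination hf₁ + hf' - a' * hu₁ - b' * hv₁⟩

lemma _root_.Nat.choose_two_second_difference (k r : ℕ) :
    (k + 2 * r + 2).choose 2 + (k + 2).choose 2 = 2 * (k + r + 2).choose 2 + r ^ 2 := by
  have : (((k + 2 * r + 2).choose 2 + (k + 2).choose 2 : ℕ) : ℚ) =
      ((2 * (k + r + 2).choose 2 + r ^ 2 : ℕ) : ℚ) := by
    push_cast [Nat.cast_choose_two]
    ring
  exact_mod_cast this

/-- In large degree, evaluation of forms at pairwise distinct projective points is surjective. -/
lemma exists_isHomogeneous_eval_eq {K ι : Type*} [Field K] [Fintype ι] {n m : ℕ}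
    {x : ι → Fin n → K} (hx0 : ∀ i, x i ≠ 0) (hx : ∀ i j, i ≠ j → ¬ ∃ c : K, x j = c • x i)
    (hm : Fintype.card ι ≤ m) (y : ι → K) :
    ∃ p : MvPolynomial (Fin n) K, p.IsHomogeneous m ∧ ∀ i, eval (x i) p = y i := by
  classical
  have hbase : ∀ i, ∃ p : MvPolynomial (Fin n) K, p.IsHomogeneous m ∧ eval (x i) p ≠ 0 ∧
      ∀ j, j ≠ i → eval (x j) p = 0 := by
    intro i
    obtain ⟨p, hp, hpi, hpj⟩ := exists_isHomogeneous_card_eval_ne_zero hx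
      (Finset.notMem_erase i Finset.univ)
    obtain ⟨f, hf⟩ := Module.Projective.exists_dual_ne_zero K (hx0 i)
    have hcard : (Finset.univ.erase i).card ≤ m := (Finset.card_le_univ _).trans hm
    refine ⟨p * ofDual f ^ (m - (Finset.univ.erase i).card), ?_, ?_, fun j hj => ?_⟩
    · have := hp.mul ((isHomogeneous_ofDual f).pow (m - (Finset.univ.erase i).card))
      rwa [one_mul, Nat.add_sub_cancel' hcard] at this
    · simpa [hpi] using fun h => absurd h hf
    · simp [hpj j (by simpa using hj)]
  choose q hq hqi hqj using hbase
  refine ⟨∑ i, C (y i / eval (x i) (q i)) * q i,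
    IsHomogeneous.sum _ _ _ fun i _ => (hq i).C_mul _, fun i => ?_⟩
  rw [map_sum, Finset.sum_eq_single i]
  · simp [hqi i]
  · intro j _ hj
    simp [hqj j i hj.symm]
  · simp

/-- If two relatively prime forms of degree `r` have `r ^ 2` distinct common zeros, then the forms
of large degree vanishing at these points are in the ideal generated by the two forms. -/
lemma exists_eq_of_eval_eq_zero_of_card_le {K ι : Type*} [Field K] [Fintype ι] {r k : ℕ}
    (hr : r ≠ 0) (hι : Fintype.card ι = r ^ 2) {u v : MvPolynomial (Fin 3) K}
    (hu : u.IsHomogeneous r) (hv : v.IsHomogeneous r) (huv : IsRelPrime u v)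
    {x : ι → Fin 3 → K} (hx0 : ∀ i, x i ≠ 0) (hx : ∀ i j, i ≠ j → ¬ ∃ c : K, x j = c • x i)
    (hxz : ∀ i, eval (x i) u = 0 ∧ eval (x i) v = 0) (hk : r ^ 2 ≤ k + 2 * r)
    {p : MvPolynomial (Fin 3) K} (hp : p.IsHomogeneous (k + 2 * r))
    (hpx : ∀ i, eval (x i) p = 0) : ∃ a b, p = a * u + b * v := by
  have hv0 : v ≠ 0 := hu.ne_zero_of_isRelPrime hr huv
  let V := homogeneousSubmodule (Fin 3) K
  have hmul : ∀ {w : MvPolynomial (Fin 3) K}, w.IsHomogeneous r → ∀ n,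
      ∀ a ∈ V n, LinearMap.mulRight K w a ∈ V (n + r) := fun hw n a ha =>
    IsHomogeneous.mul ha hw
  have h2 : k + r + r = k + 2 * r := by ring
  let T : V (k + r) × V (k + r) →ₗ[K] V (k + r + r) :=
    ((LinearMap.mulRight K u).restrict (hmul hu (k + r))).coprod
      ((LinearMap.mulRight K v).restrict (hmul hv (k + r)))
  let S : V k →ₗ[K] V (k + r) × V (k + r) :=
    ((LinearMap.mulRight K v).restrict (hmul hv k)).prod
      (-(LinearMap.mulRight K u).restrict (hmul hu k))
  let E : V (k + r + r) →ₗ[K] (ι → K) :=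
    LinearMap.pi fun i => (aeval (R := K) (x i)).toLinearMap ∘ₗ (V (k + r + r)).subtype
  have hT : ∀ z, (T z : MvPolynomial (Fin 3) K) = z.1 * u + z.2 * v := fun z => rfl
  have hE : ∀ z i, E z i = eval (x i) (z : MvPolynomial (Fin 3) K) := fun z i => rfl
  have hker : LinearMap.ker T ≤ LinearMap.range S := by
    rintro ⟨⟨a, ha⟩, ⟨b, hb⟩⟩ hab
    have hab' : a * u + b * v = 0 := by
      rw [← hT (⟨a, ha⟩, ⟨b, hb⟩), LinearMap.mem_ker.1 hab]; rfl
    obtain ⟨c, rfl, rfl⟩ := exists_of_mul_add_mul_eq_zero huv hv0 hab'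
    have hhom : (c * v).IsHomogeneous (k + r) := ha
    obtain ⟨c', hc', hcc⟩ := exists_homogeneousComponent_mul hv c (k + r)
    rw [homogeneousComponent_eq_self hhom, Nat.add_sub_cancel] at *
    obtain rfl := mul_right_cancel₀ hv0 hcc
    refine ⟨⟨c, hc'⟩, ?_⟩
    refine Prod.ext (Subtype.ext rfl) (Subtype.ext ?_)
    exact (neg_mul c u).symm
  have hrange : LinearMap.range T ≤ LinearMap.ker E := by
    rintro _ ⟨z, rfl⟩
    rw [LinearMap.mem_ker]
    ext i
    rw [hE, hT]
    simp [hxz i]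
  have hEsurj : LinearMap.range E = ⊤ := by
    rw [LinearMap.range_eq_top]
    intro y
    obtain ⟨q, hq, hqy⟩ := exists_isHomogeneous_eval_eq hx0 hx (m := k + r + r)
      (by rw [hι, h2]; exact hk) y
    exact ⟨⟨q, hq⟩, _root_.funext hqy⟩
  have hVn : ∀ n, Module.finrank K (V n) = (n + 2).choose 2 :=
    finrank_homogeneousSubmodule_fin_three K
  have h₁ := LinearMap.finrank_range_add_finrank_ker T
  have h₂ := LinearMap.finrank_range_add_finrank_ker E
  have h₃ := (Submodule.finrank_mono hker).trans (LinearMap.finrank_range_le S)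
  rw [Module.finrank_prod, hVn] at h₁
  rw [hEsurj, finrank_top, Module.finrank_fintype_fun_eq_card, hι, hVn, show k + r + r + 2 = k + 2 * r + 2 by omega] at h₂
  rw [hVn] at h₃
  have h₄ := Nat.choose_two_second_difference k r
  have heq : LinearMap.range T = LinearMap.ker E :=
    Submodule.eq_of_le_of_finrank_le hrange (by omega)
  have hpE : (⟨p, by rw [h2]; exact hp⟩ : V (k + r + r)) ∈ LinearMap.ker E := by
    rw [LinearMap.mem_ker]
    exact _root_.funext hpx
  rw [← heq] at hpE
  obtain ⟨z, hz⟩ := hpE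
  exact ⟨z.1, z.2, by rw [← hT, hz]⟩

/-- If two relatively prime forms of degree `r` have exactly `r ^ 2` common projective zeros, then
every form vanishing at these points is in the ideal generated by the two forms. -/
lemma exists_eq_of_eval_eq_zero {K ι : Type*} [Field K] [Fintype ι] {r n : ℕ}
    (hr : r ≠ 0) (hι : Fintype.card ι = r ^ 2) {u v : MvPolynomial (Fin 3) K}
    (hu : u.IsHomogeneous r) (hv : v.IsHomogeneous r) (huv : IsRelPrime u v)
    {x : ι → Fin 3 → K} (hx0 : ∀ i, x i ≠ 0) (hx : ∀ i j, i ≠ j → ¬ ∃ c : K, x j = c • x i)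
    (hxz : ∀ i, eval (x i) u = 0 ∧ eval (x i) v = 0) {ℓ : MvPolynomial (Fin 3) K}
    (hℓ : ℓ.IsHomogeneous 1)
    (hreg : ∀ q, (∃ a b, ℓ * q = a * u + b * v) → ∃ a b, q = a * u + b * v)
    {p : MvPolynomial (Fin 3) K} (hp : p.IsHomogeneous n)
    (hpx : ∀ i, eval (x i) p = 0) : ∃ a b, p = a * u + b * v := by
  have hpow : ∀ s, (∃ a b, ℓ ^ s * p = a * u + b * v) → ∃ a b, p = a * u + b * v := by
    intro s
    induction s with
    | zero => simp
    | succ s ih =>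
      intro h
      refine ih (hreg _ ?_)
      rwa [← mul_assoc, ← pow_succ']
  refine hpow (r ^ 2 + 2 * r) ?_
  have hdeg : (ℓ ^ (r ^ 2 + 2 * r) * p).IsHomogeneous (r ^ 2 + n + 2 * r) := by
    have := (hℓ.pow (r ^ 2 + 2 * r)).mul hp
    rwa [one_mul, add_right_comm] at this
  exact exists_eq_of_eval_eq_zero_of_card_le hr hι hu hv huv hx0 hx hxz (by omega) hdeg
    (by simp [hpx])

/-- **Cayley-Bacharach theorem** for two forms of degree `r` with exactly `r ^ 2` common projective
zeros: a form of degree at most `2 * r - 3` vanishing at all of these points but one vanishes at the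
last one as well. -/
theorem cayleyBacharach {K ι : Type*} [Field K] [IsAlgClosed K] [Fintype ι] {r : ℕ}
    (hr : 2 ≤ r) (hι : Fintype.card ι = r ^ 2) {u v : MvPolynomial (Fin 3) K}
    (hu : u.IsHomogeneous r) (hv : v.IsHomogeneous r) (huv : IsRelPrime u v)
    {x : ι → Fin 3 → K} (hx0 : ∀ i, x i ≠ 0) (hx : ∀ i j, i ≠ j → ¬ ∃ c : K, x j = c • x i)
    (hxz : ∀ i, eval (x i) u = 0 ∧ eval (x i) v = 0)
    (hxall : ∀ y, y ≠ 0 → eval y u = 0 → eval y v = 0 → ∃ i, ∃ c : K, y = c • x i)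
    {e : ℕ} (he : e + 3 ≤ 2 * r) {p : MvPolynomial (Fin 3) K} (hp : p.IsHomogeneous e) {i : ι}
    (hpx : ∀ j, j ≠ i → eval (x j) p = 0) : eval (x i) p = 0 := by
  obtain ⟨f, hf⟩ := Module.exists_dual_forall_apply_ne_zero (K := K)
    (fun j : Option ι => j.elim (Pi.single (0 : Fin 3) (1 : K)) x) (by
      rintro (_ | j)
      · simp
      · exact hx0 j)
  have hf0 : f (Pi.single 0 1) ≠ 0 := hf none
  have hfx : ∀ j, f (x j) ≠ 0 := fun j => hf (some j)
  obtain ⟨φ, hφℓ, hφX, hφ, hφh⟩ := exists_restriction hf0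
  have hℓ := isHomogeneous_ofDual f
  have hℓ0 : ofDual f ≠ 0 := fun h => hf0 (by rw [← eval_ofDual, h, map_zero])
  have hzero : ∀ y, eval y u = 0 → eval y v = 0 → eval y (ofDual f) = 0 → y = 0 := by
    intro y hyu hyv hy
    by_contra hy0
    obtain ⟨j, c, rfl⟩ := hxall y hy0 hyu hyv
    rw [eval_ofDual, map_smul, smul_eq_mul, mul_eq_zero] at hy
    rcases hy with rfl | hy
    · exact hy0 (zero_smul _ _)
    · exact hfx j hy
  have hφuv := isRelPrime_restriction hzero hφℓ hφX
  have hφv : φ v ≠ 0 := (hφh u r hu).ne_zero_of_isRelPrime (by omega) hφuv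
  have hmem : ∀ {n : ℕ} {q : MvPolynomial (Fin 3) K}, q.IsHomogeneous n →
      (∀ j, eval (x j) q = 0) → ∃ a b, q = a * u + b * v := fun hq hqx =>
    exists_eq_of_eval_eq_zero (by omega) hι hu hv huv hx0 hx hxz hℓ
      (fun q ⟨a, b, hab⟩ => exists_eq_of_mul_eq (φ := (φ : _ →+* _)) hℓ0 hφℓ hφ hφuv hφv hab) hq hqx
  induction e generalizing p with
  | zero =>
    obtain ⟨j, hj⟩ : ∃ j, j ≠ i := by
      have : Nontrivial ι := Fintype.one_lt_card_iff_nontrivial.1 (by rw [hι]; nlinarith)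
      exact exists_ne i
    have hC := totalDegree_eq_zero_iff_eq_C.1 ((totalDegree_zero_iff_isHomogeneous _).2 hp)
    have hpj := hpx j hj
    rw [hC, eval_C] at hpj ⊢
    exact hpj
  | succ e ih =>
    obtain ⟨a, b, c, habc⟩ := exists_eq_of_X_mul_eq hp hu hv hr he hφℓ hφX hφ hφh hφuv (by
      intro k _
      obtain ⟨a, b, hab⟩ := hmem (q := X k * p - C (x i k / f (x i)) * (ofDual f * p))
        (((isHomogeneous_X K k).mul hp).sub ((hℓ.mul hp).C_mul _)) (by
          intro j
          by_cases hj : j = i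
          · subst hj
            have := hfx j
            simp only [map_sub, map_mul, eval_X, eval_C, eval_ofDual]
            field_simp
            ring
          · simp [hpx j hj])
      exact ⟨a, b, C (x i k / f (x i)) * p, by linear_combination hab⟩)
    obtain ⟨a', -, ha⟩ := exists_homogeneousComponent_mul hu a (e + 1)
    obtain ⟨b', -, hb⟩ := exists_homogeneousComponent_mul hv b (e + 1)
    obtain ⟨c', hc', hc⟩ := exists_homogeneousComponent_mul hℓ c (e + 1)
    have hp' : p = a' * u + b' * v + c' * ofDual f := by
      rw [← ha, ← hb, ← hc, ← map_add, ← map_add, ← habc, homogeneousComponent_eq_self hp]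
    have heval : ∀ j, eval (x j) p = eval (x j) c' * f (x j) := fun j => by
      rw [hp']
      simp [hxz j]
    have hci : eval (x i) c' = 0 := ih (by omega) hc' fun j hj => by
      have h0 := hpx j hj
      rw [heval] at h0
      exact (mul_eq_zero.1 h0).resolve_right (hfx j)
    rw [heval, hci, zero_mul]

end MvPolynomial

/-- **Degree budget lemma.** With `g₁, g₂` homogeneous of degree `r` with no
common irreducible factor and exactly `r²` distinct common projective zeros, a homogeneous
polynomial `h` of degree `d` with `d + (t − 1) ≤ 2r − 3` and `t ≥ 1` cannot vanish at
exactly `r² − t` of the points while failing to vanish at exactly `t` of them. -/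
theorem stmt9 (K : Type*) [Field K] [IsAlgClosed K] (r : ℕ) (hr : 3 ≤ r)
    (g₁ g₂ : MvPolynomial (Fin 3) K)
    (hg₁ : g₁.IsHomogeneous r) (hg₂ : g₂.IsHomogeneous r)
    (hcop : ¬ ∃ p : MvPolynomial (Fin 3) K, Irreducible p ∧ p ∣ g₁ ∧ p ∣ g₂)
    -- representatives of the r² common projective zeros
    (x : Fin (r ^ 2) → Fin 3 → K)
    (hx0 : ∀ i, x i ≠ 0)
    (hxz : ∀ i, MvPolynomial.eval (x i) g₁ = 0 ∧ MvPolynomial.eval (x i) g₂ = 0)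
    (hxdist : ∀ i j, i ≠ j → ¬ ∃ c : K, x j = c • x i)
    (hxall : ∀ y : Fin 3 → K, y ≠ 0 → MvPolynomial.eval y g₁ = 0 →
      MvPolynomial.eval y g₂ = 0 → ∃ i, ∃ c : K, y = c • x i)
    (h : MvPolynomial (Fin 3) K) (d t : ℕ) (hh : h.IsHomogeneous d)
    (ht : 1 ≤ t) (hdt : d + (t - 1) ≤ 2 * r - 3) :
    ¬ ({i : Fin (r ^ 2) | MvPolynomial.eval (x i) h = 0}.ncard = r ^ 2 - t ∧
       {i : Fin (r ^ 2) | MvPolynomial.eval (x i) h ≠ 0}.ncard = t) := by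
  rintro ⟨-, hcard⟩
  have huv : IsRelPrime g₁ g₂ := by
    refine WfDvdMonoid.isRelPrime_of_no_irreducible_factors ?_ fun p hp h₁ h₂ => hcop ⟨p, hp, h₁, h₂⟩
    rintro ⟨rfl, rfl⟩
    exact hcop ⟨_, (MvPolynomial.X_prime (i := (0 : Fin 3))).irreducible, dvd_zero _, dvd_zero _⟩
  classical
  let s : Finset (Fin (r ^ 2)) := {i | MvPolynomial.eval (x i) h ≠ 0}
  have hs : s.card = t := by
    rw [← hcard, ← Set.ncard_coe_finset]
    simp [s]
  obtain ⟨i, hi⟩ : s.Nonempty := Finset.card_pos.1 (by omega)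
  obtain ⟨q, hq, hqi, hqj⟩ :=
    MvPolynomial.exists_isHomogeneous_card_eval_ne_zero hxdist (Finset.notMem_erase i s)
  rw [Finset.card_erase_of_mem hi, hs] at hq
  have hzero := MvPolynomial.cayleyBacharach (by omega) (Fintype.card_fin _) hg₁ hg₂ huv hx0 hxdist
    hxz hxall (by omega) (hh.mul hq) (i := i) fun j hj => by
      rw [map_mul, mul_eq_zero]
      by_cases hjs : j ∈ s
      · exact Or.inr (hqj j (Finset.mem_erase.2 ⟨hj, hjs⟩))
      · exact Or.inl (by simpa [s] using hjs)
  rw [map_mul] at hzero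
  exact mul_ne_zero (by simpa [s] using hi) hqi hzero
end
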